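/- Let n m : ℕ, let T ⊆ ℝ be nonempty and compact, and let Γ : ℝ → Matrix (Fin n) (Fin m) ℝ be continuous. Then for every c ≥ 0 the multi-impulse reachable set S*(c,T) is a compact convex subset of ℝⁿ. -/

import Mathlib

open Matrix
open scoped RealInnerProductSpace

/-- Single-impulse reachable set `S(c,T)`: states reachable by one impulse of cost at most `c`
applied at some time in `T`. -/
noncomputable def singleReach (n m : ℕ) (Γ : ℝ → Matrix (Fin n) (Fin m) ℝ) (c : ℝ) (T : Set ℝ) :
    Set (EuclideanSpace ℝ (Fin n)) :=
  {y | ∃ t ∈ T, ∃ u : EuclideanSpace ℝ (Fin m), ‖u‖ ≤ c ∧ y = (Γ t).mulVec u}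

/-- Multi-impulse reachable set `S*(c,T)`: states reachable by finitely many impulses at times in
`T` of total cost at most `c`. -/
noncomputable def multiReach (n m : ℕ) (Γ : ℝ → Matrix (Fin n) (Fin m) ℝ) (c : ℝ) (T : Set ℝ) :
    Set (EuclideanSpace ℝ (Fin n)) :=
  {y | ∃ k : ℕ, ∃ t : Fin k → ℝ, ∃ u : Fin k → EuclideanSpace ℝ (Fin m),
      (∀ j, t j ∈ T) ∧ (∑ j, ‖u j‖) ≤ c ∧ y = ∑ j, (Γ (t j)).mulVec (u j)}


/-- In a finite-dimensional space, the convex hull of a compact set is compact. -/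
theorem IsCompact.isCompact_convexHull_of_finiteDimensional {E : Type*} [NormedAddCommGroup E]
    [NormedSpace ℝ E] [FiniteDimensional ℝ E] {s : Set E} (hs : IsCompact s) :
    IsCompact (convexHull ℝ s) := by
  have key : convexHull ℝ s = ⋃ k ∈ Finset.range (Module.finrank ℝ E + 2),
      (fun p : (Fin k → ℝ) × (Fin k → E) => ∑ i, p.1 i • p.2 i) ''
        (stdSimplex ℝ (Fin k) ×ˢ Set.univ.pi fun _ => s) := by
    ext x
    simp only [Set.mem_iUnion, Set.mem_image, Set.mem_prod, Prod.exists, exists_prop,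
      Finset.mem_range]
    constructor
    · intro hx
      obtain ⟨ι, _, z, w, hz, hind, hw, hw1, rfl⟩ := eq_pos_convex_span_of_mem_convexHull hx
      let e := Fintype.equivFin ι
      have hcard := hind.card_le_finrank_succ
      have hle := Submodule.finrank_le (vectorSpan ℝ (Set.range z))
      refine ⟨Fintype.card ι, by omega, w ∘ e.symm, z ∘ e.symm, ⟨⟨fun i => (hw _).le, ?_⟩,
        fun i _ => hz ⟨_, rfl⟩⟩, ?_⟩
      · rw [← hw1]; exact e.symm.sum_comp w
      · exact e.symm.sum_comp fun i => w i • z i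
    · rintro ⟨k, -, w, z, ⟨hw, hz⟩, rfl⟩
      exact (convex_convexHull ℝ s).sum_mem (fun i _ => hw.1 i) hw.2
        fun i hi => subset_convexHull ℝ s (hz i trivial)
  rw [key]
  refine (Finset.range _).isCompact_biUnion fun k _ => ?_
  exact ((isCompact_stdSimplex ℝ (Fin k)).prod (isCompact_univ_pi fun _ => hs)).image (by fun_prop)

theorem isCompact_singleReach {n m : ℕ} {T : Set ℝ} (hT : IsCompact T)
    {Γ : ℝ → Matrix (Fin n) (Fin m) ℝ} (hΓ : Continuous Γ) (c : ℝ) :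
    IsCompact (singleReach n m Γ c T) := by
  have key : singleReach n m Γ c T =
      (fun p : ℝ × EuclideanSpace ℝ (Fin m) => WithLp.toLp 2 ((Γ p.1).mulVec p.2)) ''
        (T ×ˢ Metric.closedBall 0 c) := by
    ext y
    simp only [singleReach, Set.mem_ofPred_eq, Set.mem_image, Set.mem_prod, Prod.exists,
      mem_closedBall_zero_iff]
    constructor
    · rintro ⟨t, ht, u, hu, hy⟩
      exact ⟨t, u, ⟨ht, hu⟩, by rw [← hy]⟩
    · rintro ⟨t, u, ⟨ht, hu⟩, rfl⟩
      exact ⟨t, ht, u, hu, rfl⟩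
  rw [key]
  refine (hT.prod (isCompact_closedBall 0 c)).image ?_
  refine (PiLp.continuous_toLp 2 _).comp ?_
  exact (hΓ.comp continuous_fst).matrix_mulVec ((PiLp.continuous_ofLp 2 _).comp continuous_snd)

theorem singleReach_subset_multiReach {n m : ℕ} (Γ : ℝ → Matrix (Fin n) (Fin m) ℝ) (c : ℝ)
    (T : Set ℝ) : singleReach n m Γ c T ⊆ multiReach n m Γ c T := by
  rintro y ⟨t, ht, u, hu, hy⟩
  exact ⟨1, fun _ => t, fun _ => u, fun _ => ht, by simpa using hu, by simpa using hy⟩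

theorem convex_multiReach {n m : ℕ} (Γ : ℝ → Matrix (Fin n) (Fin m) ℝ) (c : ℝ)
    (T : Set ℝ) : Convex ℝ (multiReach n m Γ c T) := by
  rintro x ⟨k, t, u, ht, hu, hx⟩ y ⟨l, s, v, hs, hv, hy⟩ a b ha hb hab
  refine ⟨k + l, Fin.append t s, Fin.append (a • u) (b • v), ?_, ?_, ?_⟩
  · exact Fin.addCases (by simpa using ht) (by simpa using hs)
  · simp only [Fin.sum_univ_add, Fin.append_left, Fin.append_right, Pi.smul_apply, norm_smul,
      Real.norm_of_nonneg ha, Real.norm_of_nonneg hb, ← Finset.mul_sum]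
    calc _ ≤ a * c + b * c := by gcongr
      _ = c := by rw [← add_mul, hab, one_mul]
  · simp [Fin.sum_univ_add, hx, hy, Finset.smul_sum, Matrix.mulVec_smul]

theorem multiReach_eq_convexHull_singleReach {n m : ℕ} (Γ : ℝ → Matrix (Fin n) (Fin m) ℝ)
    {c : ℝ} (hc : 0 ≤ c) {T : Set ℝ} (hT : T.Nonempty) :
    multiReach n m Γ c T = convexHull ℝ (singleReach n m Γ c T) := by
  refine Set.Subset.antisymm ?_
    (convexHull_min (singleReach_subset_multiReach Γ c T) (convex_multiReach Γ c T))
  rintro y ⟨k, t, u, ht, hu, hy⟩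
  set w := ∑ j, ‖u j‖ with hw
  have hw0 : 0 ≤ w := Finset.sum_nonneg fun _ _ => norm_nonneg _
  rcases hw0.eq_or_lt with h | h
  · have hz : ∀ j, u j = 0 := fun j => norm_eq_zero.1 <|
      (Finset.sum_eq_zero_iff_of_nonneg fun _ _ => norm_nonneg _).1 h.symm j (Finset.mem_univ j)
    obtain ⟨t₀, ht₀⟩ := hT
    exact subset_convexHull ℝ _ ⟨t₀, ht₀, 0, by simpa using hc, by simp [hy, hz]⟩
  · have hsum : y = ∑ j, (‖u j‖ / w) •
        WithLp.toLp 2 ((Γ (t j)).mulVec ((w / ‖u j‖) • u j : EuclideanSpace ℝ (Fin m))) := by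
      apply WithLp.ofLp_injective 2
      rw [hy, WithLp.ofLp_sum]
      refine Finset.sum_congr rfl fun j _ => ?_
      by_cases hj : u j = 0
      · simp [hj]
      · have : ‖u j‖ ≠ 0 := norm_ne_zero_iff.2 hj
        rw [WithLp.ofLp_smul, WithLp.ofLp_smul, Matrix.mulVec_smul, smul_smul,
          div_mul_div_cancel₀ h.ne', div_self this, one_smul]
    rw [hsum]
    refine (convex_convexHull ℝ _).sum_mem (fun j _ => by positivity)
      (by rw [← Finset.sum_div, ← hw, div_self h.ne']) fun j _ => subset_convexHull ℝ _
        ⟨t j, ht j, (w / ‖u j‖) • u j, ?_, rfl⟩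
    rw [norm_smul, Real.norm_of_nonneg (by positivity)]
    by_cases hj : u j = 0
    · simpa [hj] using hc
    · rwa [div_mul_cancel₀ _ (norm_ne_zero_iff.2 hj)]

/-- For nonempty compact `T` and continuous `Γ`, the multi-impulse reachable set `S*(c,T)` is a
compact convex subset of `ℝⁿ`. -/
theorem multiReach_isCompact_convex (n m : ℕ) (T : Set ℝ) (hT : T.Nonempty)
    (hTc : IsCompact T) (Γ : ℝ → Matrix (Fin n) (Fin m) ℝ) (hΓ : Continuous Γ)
    (c : ℝ) (hc : 0 ≤ c) :
    IsCompact (multiReach n m Γ c T) ∧ Convex ℝ (multiReach n m Γ c T) := by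
  refine ⟨?_, convex_multiReach Γ c T⟩
  rw [multiReach_eq_convexHull_singleReach Γ hc hT]
  exact (isCompact_singleReach hTc hΓ c).isCompact_convexHull_of_finiteDimensional
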